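/- Let n ≥ 2 and 1 ≤ k ≤ n. The function f(λ) := log σ_k(λ) is well defined and smooth on the cone Γ_k, is concave on Γ_k, and satisfies ∂f/∂λᵢ > 0 on Γ_k for every i = 1,…,n. -/

import Mathlib

/-- The `k`-th elementary symmetric polynomial `σ_k` on `ℝⁿ`. -/
noncomputable def esymm (n k : ℕ) (x : Fin n → ℝ) : ℝ :=
  ∑ s ∈ Finset.powersetCard k (Finset.univ : Finset (Fin n)), ∏ i ∈ s, x i

/-- The standard `k`-positive cone `Γ_k = {x ∈ ℝⁿ : σ₁(x) > 0, …, σ_k(x) > 0}`. -/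
def gammaCone (n k : ℕ) : Set (Fin n → ℝ) :=
  {x | ∀ j : ℕ, 1 ≤ j → j ≤ k → 0 < esymm n j x}

open Polynomial in
/-- The derivative of a real polynomial with only real roots has only real roots. -/
theorem Polynomial.Splits.derivative_real {p : ℝ[X]} (hp : p.Splits) :
    (derivative p).Splits := by
  rw [splits_iff_card_roots] at hp ⊢
  have h₁ := card_roots_le_derivative p
  have h₂ := natDegree_derivative_le p
  have h₃ := card_roots' (derivative p)
  omega

open Polynomial in
/-- The Laguerre inequality for real polynomials with only real roots. -/
theorem Polynomial.Splits.eval_mul_eval_derivative_two_le {p : ℝ[X]} (hp : p.Splits) (t : ℝ) :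
    p.eval t * (derivative (derivative p)).eval t ≤ (derivative p).eval t ^ 2 := by
  obtain ⟨m, hm⟩ := splits_iff_exists_multiset.mp hp
  rw [hm]
  generalize p.leadingCoeff = c
  clear hm hp
  induction m using Multiset.induction_on with
  | empty => simp
  | cons a s ih =>
    have key : C c * ((a ::ₘ s).map (X - C ·)).prod =
        (X - C a) * (C c * (s.map (X - C ·)).prod) := by
      rw [Multiset.map_cons, Multiset.prod_cons]; ring
    rw [key]
    generalize C c * (s.map (X - C ·)).prod = q at ih ⊢
    simp only [derivative_mul, derivative_add, derivative_sub, derivative_X, derivative_C,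
      eval_add, eval_mul, eval_sub, eval_X, eval_C, sub_zero, one_mul]
    nlinarith [mul_le_mul_of_nonneg_left ih (sq_nonneg (t - a)), sq_nonneg (q.eval t)]

open Polynomial in
/-- Log-concavity of the coefficients of a real polynomial with only real roots. -/
theorem Polynomial.Splits.coeff_mul_coeff_add_two_le {p : ℝ[X]} (hp : p.Splits) (m : ℕ) :
    (m + 2) * (p.coeff m * p.coeff (m + 2)) ≤ (m + 1) * p.coeff (m + 1) ^ 2 := by
  induction m generalizing p with
  | zero =>
    have h := hp.eval_mul_eval_derivative_two_le 0
    simp only [← coeff_zero_eq_eval_zero, coeff_derivative] at h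
    norm_num at h ⊢
    linarith
  | succ m ih =>
    have h := ih hp.derivative_real
    simp only [coeff_derivative] at h
    push_cast at h ⊢
    have hm : (0 : ℝ) < (m + 1) * (m + 2) := by positivity
    refine le_of_mul_le_mul_left ?_ hm
    rw [show m + 1 + 2 = m + 2 + 1 from rfl]
    linarith

namespace Finset

variable {ι : Type*}

/-- The `k`-th elementary symmetric function of the values `x i`, `i ∈ S`. -/
noncomputable def esymmOn (S : Finset ι) (k : ℕ) (x : ι → ℝ) : ℝ :=
  ∑ s ∈ powersetCard k S, ∏ i ∈ s, x i

@[simp]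
theorem esymmOn_zero (S : Finset ι) (x : ι → ℝ) : S.esymmOn 0 x = 1 := by
  simp [esymmOn]

theorem esymmOn_one (S : Finset ι) (x : ι → ℝ) : S.esymmOn 1 x = ∑ i ∈ S, x i := by
  simp [esymmOn, powersetCard_one]

theorem esymmOn_smul (S : Finset ι) (k : ℕ) (c : ℝ) (x : ι → ℝ) :
    S.esymmOn k (c • x) = c ^ k * S.esymmOn k x := by
  rw [esymmOn, esymmOn, mul_sum]
  refine sum_congr rfl fun s hs => ?_
  simp [prod_mul_distrib, (mem_powersetCard.1 hs).2]

theorem esymmOn_congr {S : Finset ι} {x y : ι → ℝ} (h : ∀ i ∈ S, x i = y i) (k : ℕ) :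
    S.esymmOn k x = S.esymmOn k y :=
  sum_congr rfl fun _ hs => prod_congr rfl fun _ hi => h _ ((mem_powersetCard.1 hs).1 hi)

/-- Newton's inequality in its weak form, valid without sign assumptions. -/
theorem esymmOn_mul_esymmOn_add_two_le (S : Finset ι) (k : ℕ) (x : ι → ℝ) :
    S.esymmOn k x * S.esymmOn (k + 2) x ≤ S.esymmOn (k + 1) x ^ 2 := by
  by_cases hk : k + 2 ≤ #S
  · obtain ⟨m, hm⟩ := Nat.exists_eq_add_of_le hk
    have hp : (∏ i ∈ S, (Polynomial.X + Polynomial.C (x i))).Splits :=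
      Polynomial.Splits.prod fun i _ => Polynomial.Splits.X_add_C (x i)
    have h := hp.coeff_mul_coeff_add_two_le m
    rw [S.prod_X_add_C_coeff x (by omega), S.prod_X_add_C_coeff x (by omega),
      S.prod_X_add_C_coeff x (by omega), show #S - m = k + 2 by omega,
      show #S - (m + 1) = k + 1 by omega, show #S - (m + 2) = k by omega] at h
    change (m + 2) * (S.esymmOn (k + 2) x * S.esymmOn k x) ≤
      (m + 1) * S.esymmOn (k + 1) x ^ 2 at h
    have hm : (0 : ℝ) < m + 2 := by positivity
    refine le_of_mul_le_mul_left ?_ hm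
    nlinarith [sq_nonneg (S.esymmOn (k + 1) x)]
  · have h : S.esymmOn (k + 2) x = 0 := by
      rw [esymmOn, powersetCard_eq_empty.2 (by omega), sum_empty]
    rw [h, mul_zero]
    positivity

theorem esymmOn_smul_pos {S : Finset ι} {k : ℕ} {c : ℝ} (hc : 0 < c) {x : ι → ℝ}
    (hx : ∀ j ≤ k, 0 < S.esymmOn j x) : ∀ j ≤ k, 0 < S.esymmOn j (c • x) := fun j hj => by
  rw [esymmOn_smul]
  exact mul_pos (pow_pos hc j) (hx j hj)

theorem esymmOn_smul_div_esymmOn_smul (S : Finset ι) (k : ℕ) {c : ℝ} (hc : c ≠ 0)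
    (x : ι → ℝ) : S.esymmOn (k + 1) (c • x) / S.esymmOn k (c • x) =
      c * (S.esymmOn (k + 1) x / S.esymmOn k x) := by
  rw [esymmOn_smul, esymmOn_smul, pow_succ, mul_assoc, mul_div_mul_left _ _ (pow_ne_zero k hc),
    mul_div_assoc]

theorem contDiff_esymmOn [Fintype ι] (S : Finset ι) (k : ℕ) {m : WithTop ℕ∞} :
    ContDiff ℝ m (S.esymmOn k) := by
  unfold esymmOn
  fun_prop

variable [DecidableEq ι]

theorem esymmOn_insert {S : Finset ι} {a : ι} (ha : a ∉ S) (k : ℕ) (x : ι → ℝ) :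
    (insert a S).esymmOn (k + 1) x = S.esymmOn (k + 1) x + x a * S.esymmOn k x := by
  have hs : ∀ s ∈ powersetCard k S, a ∉ s := fun s hs h => ha ((mem_powersetCard.1 hs).1 h)
  rw [esymmOn, powersetCard_succ_insert ha, sum_union, sum_image, esymmOn, esymmOn, mul_sum]
  · exact congrArg _ (sum_congr rfl fun s h => prod_insert (hs s h))
  · intro s h t h' e
    rw [← erase_insert (hs s h), e, erase_insert (hs t h')]
  · rw [disjoint_left]
    intro s h h'
    obtain ⟨t, -, rfl⟩ := mem_image.1 h'
    exact ha ((mem_powersetCard.1 h).1 (mem_insert_self a t))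

theorem esymmOn_eq_erase {S : Finset ι} {a : ι} (ha : a ∈ S) (k : ℕ) (x : ι → ℝ) :
    S.esymmOn (k + 1) x = (S.erase a).esymmOn (k + 1) x + x a * (S.erase a).esymmOn k x := by
  rw [← esymmOn_insert (notMem_erase a S), insert_erase ha]

/-- Euler's identity for elementary symmetric functions. -/
theorem sum_mul_esymmOn_erase (S : Finset ι) (k : ℕ) (x : ι → ℝ) :
    ∑ i ∈ S, x i * (S.erase i).esymmOn k x = (k + 1) * S.esymmOn (k + 1) x := by
  cases k with
  | zero => simp [esymmOn_one]
  | succ k =>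
  induction S using Finset.induction_on generalizing k with
  | empty =>
    rw [sum_empty, esymmOn, powersetCard_eq_empty.2 (by simp), sum_empty, mul_zero]
  | insert a S ha ih =>
    have h : ∀ i ∈ S, x i * ((insert a S).erase i).esymmOn (k + 1) x =
        x i * (S.erase i).esymmOn (k + 1) x + x a * (x i * (S.erase i).esymmOn k x) := by
      intro i hi
      have hne : a ≠ i := fun e => ha (e ▸ hi)
      rw [erase_insert_of_ne hne, esymmOn_insert (fun h => ha (mem_of_mem_erase h))]
      ring
    have h' : ∑ i ∈ S, x i * (S.erase i).esymmOn k x = (k + 1) * S.esymmOn (k + 1) x := by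
      cases k with
      | zero => simp [esymmOn_one]
      | succ k => exact ih k
    rw [sum_insert ha, erase_insert ha, sum_congr rfl h, sum_add_distrib, ← mul_sum, ih, h',
      esymmOn_insert ha]
    push_cast
    ring

/-- Deleting a variable maps the `(k + 1)`-positive cone into the `k`-positive cone. -/
theorem esymmOn_erase_pos {S : Finset ι} {a : ι} (ha : a ∈ S) {x : ι → ℝ} {k : ℕ}
    (hx : ∀ j ≤ k + 1, 0 < S.esymmOn j x) : ∀ j ≤ k, 0 < (S.erase a).esymmOn j x := by
  intro j
  induction j with
  | zero => simp
  | succ j ih =>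
    intro hj
    have h₀ := ih (by omega)
    have h₁ := hx (j + 1) (by omega)
    have h₂ := hx (j + 2) (by omega)
    rw [esymmOn_eq_erase ha] at h₁ h₂
    have hN := (S.erase a).esymmOn_mul_esymmOn_add_two_le j x
    by_contra! hneg
    generalize (S.erase a).esymmOn j x = u at *
    generalize (S.erase a).esymmOn (j + 1) x = v at *
    generalize (S.erase a).esymmOn (j + 2) x = w at *
    have h₃ : u * (-(x a * v)) < u * w := mul_lt_mul_of_pos_left (by linarith) h₀
    have h₄ : 0 ≤ (v + x a * u) * (-v) := mul_nonneg h₁.le (by linarith)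
    nlinarith

/-- The `k`-positive cone is closed under addition, and `σ_{k+1} / σ_k` is superadditive on it. -/
theorem esymmOn_div_superadditive (k : ℕ) (S : Finset ι) {x y : ι → ℝ}
    (hx : ∀ j ≤ k, 0 < S.esymmOn j x) (hy : ∀ j ≤ k, 0 < S.esymmOn j y) :
    (∀ j ≤ k, 0 < S.esymmOn j (x + y)) ∧
      S.esymmOn (k + 1) x / S.esymmOn k x + S.esymmOn (k + 1) y / S.esymmOn k y ≤
        S.esymmOn (k + 1) (x + y) / S.esymmOn k (x + y) := by
  induction k generalizing S with
  | zero => simp [esymmOn_one, sum_add_distrib]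
  | succ k ih =>
    obtain ⟨hz, hq⟩ := ih S (fun j hj => hx j (by omega)) (fun j hj => hy j (by omega))
    have hz' : ∀ j ≤ k + 1, 0 < S.esymmOn j (x + y) := by
      intro j hj
      rcases Nat.lt_or_ge k j with h | h
      · obtain rfl : j = k + 1 := by omega
        have hpos : 0 < S.esymmOn (k + 1) (x + y) / S.esymmOn k (x + y) :=
          (add_pos (div_pos (hx _ le_rfl) (hx k (by omega)))
            (div_pos (hy _ le_rfl) (hy k (by omega)))).trans_le hq
        exact (div_pos_iff_of_pos_right (hz k le_rfl)).1 hpos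
      · exact hz j h
    refine ⟨hz', ?_⟩
    have expand : ∀ z : ι → ℝ, (∀ j ≤ k + 1, 0 < S.esymmOn j z) →
        (k + 2) * (S.esymmOn (k + 2) z / S.esymmOn (k + 1) z) =
          ∑ i ∈ S, (z i - z i ^ 2 /
            (z i + (S.erase i).esymmOn (k + 1) z / (S.erase i).esymmOn k z)) := by
      intro z h
      have hE := S.sum_mul_esymmOn_erase (k + 1) z
      rw [← mul_div_assoc, show ((k : ℝ) + 2) * S.esymmOn (k + 2) z =
        ∑ i ∈ S, z i * (S.erase i).esymmOn (k + 1) z by rw [hE]; push_cast; ring, sum_div]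
      refine sum_congr rfl fun i hi => ?_
      have h₀ := esymmOn_erase_pos hi h k le_rfl
      have h₁ := h (k + 1) le_rfl
      rw [esymmOn_eq_erase hi] at h₁ ⊢
      rw [show z i + (S.erase i).esymmOn (k + 1) z / (S.erase i).esymmOn k z =
        ((S.erase i).esymmOn (k + 1) z + z i * (S.erase i).esymmOn k z) /
          (S.erase i).esymmOn k z by field_simp; ring]
      have := h₀.ne'
      have := h₁.ne'
      field_simp
      ring
    have wpos : ∀ z : ι → ℝ, (∀ j ≤ k + 1, 0 < S.esymmOn j z) → ∀ i ∈ S,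
        0 < z i + (S.erase i).esymmOn (k + 1) z / (S.erase i).esymmOn k z := by
      intro z h i hi
      have h₀ := esymmOn_erase_pos hi h k le_rfl
      have h₁ := h (k + 1) le_rfl
      rw [esymmOn_eq_erase hi] at h₁
      rw [show z i + (S.erase i).esymmOn (k + 1) z / (S.erase i).esymmOn k z =
        ((S.erase i).esymmOn (k + 1) z + z i * (S.erase i).esymmOn k z) /
          (S.erase i).esymmOn k z by field_simp; ring]
      exact div_pos h₁ h₀
    have hk : (0 : ℝ) < k + 2 := by positivity
    refine le_of_mul_le_mul_left ?_ hk
    rw [mul_add, expand x hx, expand y hy, expand _ hz', ← sum_add_distrib]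
    refine sum_le_sum fun i hi => ?_
    have hi' := (ih (S.erase i) (esymmOn_erase_pos hi hx) (esymmOn_erase_pos hi hy)).2
    have hwx := wpos x hx i hi
    have hwy := wpos y hy i hi
    simp only [Pi.add_apply]
    generalize (S.erase i).esymmOn (k + 1) x / (S.erase i).esymmOn k x = p at *
    generalize (S.erase i).esymmOn (k + 1) y / (S.erase i).esymmOn k y = q at *
    generalize (S.erase i).esymmOn (k + 1) (x + y) / (S.erase i).esymmOn k (x + y) = r at *
    have h₁ : (x i + y i) ^ 2 / (x i + y i + r) ≤
        (x i + y i) ^ 2 / ((x i + p) + (y i + q)) := by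
      exact div_le_div_of_nonneg_left (sq_nonneg _) (by linarith) (by linarith)
    have h₂ : (x i + y i) ^ 2 / ((x i + p) + (y i + q)) ≤
        x i ^ 2 / (x i + p) + y i ^ 2 / (y i + q) := by
      rw [div_add_div _ _ hwx.ne' hwy.ne', div_le_div_iff₀ (by positivity) (by positivity)]
      nlinarith [mul_nonneg (mul_pos hwx hwy).le
        (sq_nonneg (x i * (y i + q) - y i * (x i + p)))]
    linarith

/-- Log-concavity of `σ_k` on the `k`-positive cone. -/
theorem log_esymmOn_concave (S : Finset ι) (k : ℕ) {x y : ι → ℝ}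
    (hx : ∀ j ≤ k, 0 < S.esymmOn j x) (hy : ∀ j ≤ k, 0 < S.esymmOn j y)
    {a b : ℝ} (ha : 0 < a) (hb : 0 < b) (hab : a + b = 1) :
    a * Real.log (S.esymmOn k x) + b * Real.log (S.esymmOn k y) ≤
      Real.log (S.esymmOn k (a • x + b • y)) := by
  induction k with
  | zero => simp
  | succ k ih =>
    have hx' : ∀ j ≤ k, 0 < S.esymmOn j x := fun j hj => hx j (by omega)
    have hy' : ∀ j ≤ k, 0 < S.esymmOn j y := fun j hj => hy j (by omega)
    have h := ih hx' hy'
    obtain ⟨hz, hq⟩ :=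
      esymmOn_div_superadditive k S (esymmOn_smul_pos ha hx') (esymmOn_smul_pos hb hy')
    rw [esymmOn_smul_div_esymmOn_smul S k ha.ne', esymmOn_smul_div_esymmOn_smul S k hb.ne'] at hq
    have qx : 0 < S.esymmOn (k + 1) x / S.esymmOn k x := div_pos (hx _ le_rfl) (hx' k le_rfl)
    have qy : 0 < S.esymmOn (k + 1) y / S.esymmOn k y := div_pos (hy _ le_rfl) (hy' k le_rfl)
    have hlog := strictConcaveOn_log_Ioi.concaveOn.2 qx qy ha.le hb.le hab
    simp only [smul_eq_mul] at hlog
    have hmono := Real.log_le_log (by positivity) hq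
    have hz₁ : 0 < S.esymmOn (k + 1) (a • x + b • y) :=
      (esymmOn_div_superadditive (k + 1) S (esymmOn_smul_pos ha hx)
        (esymmOn_smul_pos hb hy)).1 _ le_rfl
    rw [Real.log_div (hx _ le_rfl).ne' (hx' k le_rfl).ne',
      Real.log_div (hy _ le_rfl).ne' (hy' k le_rfl).ne'] at hlog
    rw [Real.log_div hz₁.ne' (hz k le_rfl).ne'] at hmono
    linarith

/-- The `i`-th partial derivative of `σ_{k+1}` is `σ_k` of the remaining variables. -/
theorem fderiv_esymmOn_single [Fintype ι] {S : Finset ι} {i : ι} (hi : i ∈ S) (k : ℕ)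
    (x : ι → ℝ) :
    fderiv ℝ (S.esymmOn (k + 1)) x (Pi.single i 1) = (S.erase i).esymmOn k x := by
  have hd : DifferentiableAt ℝ (S.esymmOn (k + 1)) x :=
    (contDiff_esymmOn S (k + 1) (m := 1)).differentiable one_ne_zero x
  rw [← hd.lineDeriv_eq_fderiv, lineDeriv]
  have h : (fun t : ℝ => S.esymmOn (k + 1) (x + t • Pi.single i 1)) = fun t =>
      (S.erase i).esymmOn (k + 1) x + (x i + t) * (S.erase i).esymmOn k x := by
    funext t
    have hc : ∀ l ∈ S.erase i, (x + t • (Pi.single i 1 : ι → ℝ)) l = x l := fun l hl => by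
      simp [Pi.single_eq_of_ne (ne_of_mem_erase hl)]
    rw [esymmOn_eq_erase hi, esymmOn_congr hc, esymmOn_congr hc]
    simp
  rw [h]
  simp

end Finset

theorem mem_gammaCone_iff {n k : ℕ} {x : Fin n → ℝ} :
    x ∈ gammaCone n k ↔ ∀ j ≤ k, 0 < Finset.univ.esymmOn j x := by
  refine ⟨fun h j hj => ?_, fun h j _ hj => h j hj⟩
  rcases Nat.eq_zero_or_pos j with rfl | hj'
  · simp
  · exact h j hj' hj

/-- Let `n ≥ 2` and `1 ≤ k ≤ n`.  The function `f(λ) = log σ_k(λ)` is well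
defined (since `σ_k > 0` on `Γ_k`) and smooth on the cone `Γ_k`, concave on `Γ_k`, and has
positive partial derivatives on `Γ_k`. -/
theorem stmt_14 (n k : ℕ) (hn : 2 ≤ n) (hk1 : 1 ≤ k) (hk : k ≤ n) :
    (∀ x ∈ gammaCone n k, 0 < esymm n k x) ∧
    ContDiffOn ℝ (⊤ : ℕ∞) (fun x : Fin n → ℝ => Real.log (esymm n k x))
      (gammaCone n k) ∧
    ConcaveOn ℝ (gammaCone n k) (fun x : Fin n → ℝ => Real.log (esymm n k x)) ∧
    ∀ x ∈ gammaCone n k, ∀ i : Fin n,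
      0 < fderiv ℝ (fun x : Fin n → ℝ => Real.log (esymm n k x)) x (Pi.single i 1) := by
  have hpos : ∀ x ∈ gammaCone n k, 0 < esymm n k x := fun x hx => hx k hk1 le_rfl
  have he : esymm n k = Finset.univ.esymmOn k := rfl
  refine ⟨hpos, ?_, ?_, ?_⟩
  · refine ContDiffOn.log ?_ fun x hx => (hpos x hx).ne'
    rw [he]
    exact (Finset.contDiff_esymmOn _ k).contDiffOn
  · rw [concaveOn_iff_forall_pos]
    refine ⟨convex_iff_forall_pos.2 fun x hx y hy a b ha hb _ => ?_,
      fun x hx y hy a b ha hb hab => ?_⟩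
    · rw [mem_gammaCone_iff] at hx hy ⊢
      exact (Finset.esymmOn_div_superadditive k _ (Finset.esymmOn_smul_pos ha hx)
        (Finset.esymmOn_smul_pos hb hy)).1
    · rw [mem_gammaCone_iff] at hx hy
      exact Finset.log_esymmOn_concave _ k hx hy ha hb hab
  · intro x hx i
    obtain ⟨k, rfl⟩ := Nat.exists_eq_add_of_le' hk1
    have hd : DifferentiableAt ℝ (esymm n (k + 1)) x :=
      (Finset.contDiff_esymmOn _ (k + 1) (m := 1)).differentiable one_ne_zero x
    rw [fderiv.log hd (hpos x hx).ne', he]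
    simp only [smul_apply, smul_eq_mul]
    rw [Finset.fderiv_esymmOn_single (Finset.mem_univ i)]
    exact mul_pos (inv_pos.2 (hpos x hx))
      (Finset.esymmOn_erase_pos (Finset.mem_univ i) (mem_gammaCone_iff.1 hx) k le_rfl)
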